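/- arXiv:2501.15936 — 2 statements merged into one kernel-verified Lean document; each statement's English description precedes it below -/
import Mathlib

section
/- Let d ≥ 4 be an even integer and let c(d) := Γ(d/2)/(2√π · Γ((d−1)/2)). Define K : ℝ → ℝ by K(u) := c(d) ∫₀^π (1 − cos θ · cosh u)/(cos θ − cosh u)² (sin θ)^{d−2} dθ. Then K is integrable on ℝ and for every ω ∈ ℝ one has ∫_ℝ K(u) e^{−iωu} du = 2^{d−2} Γ(d/2)² / ∏_{k=1}^{(d−2)/2} (ω² + (d−2k)²). -/
open MeasureTheory

noncomputable def sC (m : ℕ) (n : ℤ) : ℝ :=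
  ∫ θ in (0:ℝ)..Real.pi, Real.cos (n * θ) * Real.sin θ ^ (2 * m)

lemma sC_rec (m : ℕ) (n : ℤ) :
    (4 * ((m:ℝ) + 1) ^ 2 - (n:ℝ) ^ 2) * sC (m + 1) n = (2 * m + 2) * (2 * m + 1) * sC m n := by
  have key : ∫ θ in (0:ℝ)..Real.pi,
      ((4 * ((m:ℝ) + 1) ^ 2 - (n:ℝ) ^ 2) * (Real.cos (n * θ) * Real.sin θ ^ (2 * (m + 1)))
        - (2 * m + 2) * (2 * m + 1) * (Real.cos (n * θ) * Real.sin θ ^ (2 * m))) = 0 := by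
    have h := intervalIntegral.integral_eq_sub_of_hasDerivAt (a := 0) (b := Real.pi)
      (f := fun θ : ℝ => -(Real.cos (n * θ) * ((2 * m + 2) * Real.sin θ ^ (2 * m + 1) * Real.cos θ)
        + n * Real.sin (n * θ) * Real.sin θ ^ (2 * m + 2)))
      (f' := fun θ : ℝ =>
      ((4 * ((m:ℝ) + 1) ^ 2 - (n:ℝ) ^ 2) * (Real.cos (n * θ) * Real.sin θ ^ (2 * (m + 1)))
        - (2 * m + 2) * (2 * m + 1) * (Real.cos (n * θ) * Real.sin θ ^ (2 * m)))) ?_ ?_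
    · rw [h]; simp
    · intro x _
      have hnx : HasDerivAt (fun θ : ℝ => (n:ℝ) * θ) (n:ℝ) x := by
        simpa using (hasDerivAt_id x).const_mul (n:ℝ)
      have h1 := hnx.cos
      have h2 := hnx.sin
      have h3 := (Real.hasDerivAt_sin x).pow (2 * m + 1)
      have h4 := (Real.hasDerivAt_sin x).pow (2 * m + 2)
      have h5 := (h3.const_mul (2 * (m:ℝ) + 2)).mul (Real.hasDerivAt_cos x)
      refine HasDerivAt.congr_deriv (((h1.mul h5).add ((h2.const_mul (n:ℝ)).mul h4))).neg ?_
      have hc : Real.cos x ^ 2 = 1 - Real.sin x ^ 2 := by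
        have := Real.sin_sq_add_cos_sq x; linarith
      simp only [Pi.mul_apply, Pi.pow_apply, Nat.add_sub_cancel, show 2 * m + 2 - 1 = 2 * m + 1 from rfl]
      push_cast
      simp only [pow_succ, Nat.mul_add, mul_one, pow_zero] at hc ⊢
      linear_combination (-(2 * (m:ℝ) + 2) * (2 * m + 1) * Real.cos (n * x) * Real.sin x ^ (2 * m)) * hc
    · apply Continuous.intervalIntegrable; fun_prop
  rw [intervalIntegral.integral_sub, intervalIntegral.integral_const_mul,
    intervalIntegral.integral_const_mul] at key
  · unfold sC; linarith
  · apply Continuous.intervalIntegrable; fun_prop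
  · apply Continuous.intervalIntegrable; fun_prop

lemma sC_rec2 (m : ℕ) (n : ℤ) :
    sC (m + 1) n = sC m n / 2 - (sC m (n + 2) + sC m (n - 2)) / 4 := by
  unfold sC
  rw [← intervalIntegral.integral_add, ← intervalIntegral.integral_div,
    ← intervalIntegral.integral_div, ← intervalIntegral.integral_sub]
  · congr 1; ext θ
    push_cast
    rw [add_mul, sub_mul, Real.cos_add, Real.cos_sub, Real.cos_two_mul, Real.cos_sq']
    ring
  all_goals apply Continuous.intervalIntegrable; fun_prop

lemma sC_neg (m : ℕ) (n : ℤ) : sC m (-n) = sC m n := by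
  unfold sC; simp

lemma sC_zero (n : ℤ) (hn : n ≠ 0) : sC 0 n = 0 := by
  have : (n:ℝ) ≠ 0 := by exact_mod_cast hn
  unfold sC
  simp [intervalIntegral.integral_comp_mul_left (fun x => Real.cos x) this]

lemma sC_zero_zero : sC 0 0 = Real.pi := by
  unfold sC; simp

lemma sC_supp (m : ℕ) : ∀ n : ℤ, n ∉ Finset.Icc (-(2 * m : ℤ)) (2 * m) → sC m n = 0 := by
  induction m with
  | zero => intro n hn; apply sC_zero; rintro rfl; simp at hn
  | succ m ih =>
    intro n hn
    rw [Finset.mem_Icc] at hn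
    rw [sC_rec2, ih, ih, ih]
    · ring
    all_goals (rw [Finset.mem_Icc]; push_cast at hn; omega)

lemma sC_summable (m : ℕ) (φ : ℤ → ℝ) : Summable (fun n => φ n * sC m n) :=
  summable_of_ne_finset_zero (s := Finset.Icc (-(2 * m : ℤ)) (2 * m)) fun n hn => by
    rw [sC_supp m n hn, mul_zero]

lemma sC_sum_rec (m : ℕ) (φ : ℤ → ℝ) :
    ∑' n, φ n * sC (m + 1) n = ∑' n, (φ n / 2 - (φ (n - 2) + φ (n + 2)) / 4) * sC m n := by
  have e1 : ∑' n, φ n * sC m (n + 2) = ∑' n, φ (n - 2) * sC m n := by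
    rw [← (Equiv.addRight (2:ℤ)).tsum_eq (fun n => φ (n - 2) * sC m n)]
    simp
  have e2 : ∑' n, φ n * sC m (n - 2) = ∑' n, φ (n + 2) * sC m n := by
    rw [← (Equiv.subRight (2:ℤ)).tsum_eq (fun n => φ (n + 2) * sC m n)]
    simp
  have s0 := sC_summable m φ
  have s1 := sC_summable m (fun n => φ (n - 2))
  have s2 := sC_summable m (fun n => φ (n + 2))
  have s1' : Summable (fun n => φ n * sC m (n + 2)) := by
    rw [← (Equiv.addRight (2:ℤ)).summable_iff] at s1
    simpa [Function.comp_def] using s1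
  have s2' : Summable (fun n => φ n * sC m (n - 2)) := by
    rw [← (Equiv.subRight (2:ℤ)).summable_iff] at s2
    simpa [Function.comp_def] using s2
  have a : ∑' n, φ n * sC (m + 1) n = (∑' n, φ n * sC m n) / 2 -
      ((∑' n, φ n * sC m (n + 2)) + ∑' n, φ n * sC m (n - 2)) / 4 := by
    rw [← s1'.tsum_add s2', ← tsum_div_const, ← tsum_div_const,
      ← (s0.div_const 2).tsum_sub ((s1'.add s2').div_const 4)]
    congr 1; ext n; rw [sC_rec2]; ring
  rw [a, e1, e2, ← s1.tsum_add s2, ← tsum_div_const, ← tsum_div_const,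
      ← (s0.div_const 2).tsum_sub ((s1.add s2).div_const 4)]
  congr 1; ext n; ring

lemma sC_T_zero (φ : ℤ → ℝ) : ∑' n, φ n * sC 0 n = φ 0 * Real.pi := by
  rw [tsum_eq_single 0, sC_zero_zero]
  intro n hn; rw [sC_zero n hn, mul_zero]

lemma sC_M_one : ∑' n : ℤ, (n:ℝ)^2 * sC 1 n = -2 * Real.pi := by
  rw [sC_sum_rec 0 (fun n => (n:ℝ)^2), sC_T_zero]; norm_num

lemma sC_M (m : ℕ) : ∑' n : ℤ, (n:ℝ)^2 * sC (m + 2) n = 0 := by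
  rw [sC_sum_rec (m+1) (fun n => (n:ℝ)^2), sC_sum_rec]
  convert tsum_zero with n
  push_cast; ring

noncomputable def GG (m : ℕ) (ω : ℝ) : ℝ := ∑' n : ℤ, (n:ℝ)^2 / (ω^2 + n^2) * sC m n

lemma GG_rec (m : ℕ) (ω : ℝ) : (ω^2 + 4 * ((m:ℝ)+1)^2) * GG (m+1) ω =
    (2 * m + 2) * (2 * m + 1) * GG m ω + ∑' n : ℤ, (n:ℝ)^2 * sC (m + 1) n := by
  unfold GG
  rw [← tsum_mul_left, ← tsum_mul_left, ← Summable.tsum_add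
    ((sC_summable m _).mul_left _) (sC_summable _ _)]
  congr 1; ext n
  by_cases hn : n = 0
  · simp [hn]
  have : ω^2 + (n:ℝ)^2 ≠ 0 := by
    have : (n:ℝ) ≠ 0 := by exact_mod_cast hn
    positivity
  have r := sC_rec m n
  field_simp
  linear_combination r

lemma GG_eq (m : ℕ) (ω : ℝ) : GG (m+1) ω * ∏ j ∈ Finset.range (m+1), (ω^2 + 4 * ((j:ℝ)+1)^2) =
    - Real.pi * (2 * (m + 1)).factorial := by
  induction m with
  | zero =>
    have h := GG_rec 0 ω
    rw [show GG 0 ω = 0 by unfold GG; rw [sC_T_zero]; simp, sC_M_one] at h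
    simp at h ⊢
    rw [mul_comm, h]; ring
  | succ m ih =>
    have h := GG_rec (m+1) ω
    rw [sC_M] at h
    rw [Finset.prod_range_succ]
    have f : ((2 * (m + 1 + 1)).factorial : ℝ) =
        (2 * (m+1) + 2) * (2 * (m+1) + 1) * (2 * (m+1)).factorial := by
      rw [show 2 * (m + 1 + 1) = 2 * (m+1) + 1 + 1 by ring, Nat.factorial_succ, Nat.factorial_succ]
      push_cast; ring
    rw [f]
    push_cast at h ⊢
    linear_combination (2 * ((m:ℝ)+1) + 2) * (2 * (m+1) + 1) * ih + (∏ j ∈ Finset.range (m+1), (ω^2 + 4 * ((j:ℝ)+1)^2)) * h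

lemma Gamma_half (m : ℕ) : Real.Gamma ((m:ℝ) + 1/2) * (4^m * m.factorial) =
    (2*m).factorial * Real.sqrt Real.pi := by
  induction m with
  | zero => simp [-one_div, Real.Gamma_one_half_eq]
  | succ m ih =>
    rw [show ((m+1:ℕ):ℝ) + 1/2 = ((m:ℝ) + 1/2) + 1 by push_cast; ring,
      Real.Gamma_add_one (by positivity), show 2 * (m + 1) = 2 * m + 1 + 1 by ring,
      Nat.factorial_succ, Nat.factorial_succ, Nat.factorial_succ]
    push_cast
    rw [pow_succ]
    linear_combination (4 * (m + 1/2) * (m+1):ℝ) * ih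

lemma ft_exp (a : ℝ) (ha : 0 < a) (ω : ℝ) :
    Integrable (fun u : ℝ => (Real.exp (-a * |u|) : ℂ) * Complex.exp (-Complex.I * ω * u)) ∧
    ∫ u : ℝ, (Real.exp (-a * |u|) : ℂ) * Complex.exp (-Complex.I * ω * u) =
      ((2 * a / (ω^2 + a^2) : ℝ) : ℂ) := by
  have h1 : (-(a:ℂ) - Complex.I * ω).re < 0 := by simp [ha]
  have h2 : 0 < ((a:ℂ) - Complex.I * ω).re := by simp [ha]
  have e1 : Set.EqOn (fun u : ℝ => Complex.exp ((-(a:ℂ) - Complex.I * ω) * u)) (fun u : ℝ => (Real.exp (-a * |u|) : ℂ) * Complex.exp (-Complex.I * ω * u)) (Set.Ioi 0) := by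
    intro u hu
    simp only [abs_of_pos (Set.mem_Ioi.1 hu)]
    push_cast; rw [← Complex.exp_add]; congr 1; ring
  have e2 : Set.EqOn (fun u : ℝ => Complex.exp (((a:ℂ) - Complex.I * ω) * u)) (fun u : ℝ => (Real.exp (-a * |u|) : ℂ) * Complex.exp (-Complex.I * ω * u)) (Set.Iic 0) := by
    intro u hu
    simp only [abs_of_nonpos (Set.mem_Iic.1 hu)]
    push_cast; rw [← Complex.exp_add]; congr 1; ring
  have i1 := (integrableOn_exp_mul_complex_Ioi h1 0).congr_fun e1 measurableSet_Ioi
  have i2 := (integrableOn_exp_mul_complex_Iic h2 0).congr_fun e2 measurableSet_Iic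
  constructor
  · rw [← integrableOn_univ, ← Set.Iic_union_Ioi (a := (0:ℝ))]
    exact i2.union i1
  · rw [← intervalIntegral.integral_Iic_add_Ioi i2 i1, ← setIntegral_congr_fun measurableSet_Ioi e1,
      ← setIntegral_congr_fun measurableSet_Iic e2, integral_exp_mul_complex_Ioi h1,
      integral_exp_mul_complex_Iic h2]
    have n1 : (-(a:ℂ) - Complex.I * ω) ≠ 0 := fun h => by rw [h] at h1; simp at h1
    have n2 : ((a:ℂ) - Complex.I * ω) ≠ 0 := fun h => by rw [h] at h2; simp at h2
    have n3 : ((ω:ℂ)^2 + a^2) ≠ 0 := by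
      have : ω^2 + a^2 ≠ 0 := by positivity
      exact_mod_cast this
    push_cast
    simp only [mul_zero, Complex.exp_zero]
    field_simp
    ring_nf
    simp only [Complex.I_sq]
    ring

lemma poisson (v θ : ℝ) (hv : 0 < v) :
    HasSum (fun n : ℕ => (n:ℝ) * Real.exp (-n * v) * Real.cos (n * θ))
      (- (1/2) * ((1 - Real.cos θ * Real.cosh v) / (Real.cos θ - Real.cosh v)^2)) := by
  set z : ℂ := Complex.exp (-v + θ * Complex.I) with hz
  have hn : ‖z‖ < 1 := by simp [hz, Complex.norm_exp, hv]
  have h := hasSum_coe_mul_geometric_of_norm_lt_one hn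
  have h' := Complex.hasSum_re h
  have hne : (1 - z) ≠ 0 := by
    intro h0
    have : z = 1 := by linear_combination -h0
    rw [this] at hn; simp at hn
  have hch : 1 < Real.cosh v := Real.one_lt_cosh.2 hv.ne'
  have hne2 : Real.cos θ - Real.cosh v ≠ 0 := by
    have := Real.cos_le_one θ; intro h; linarith
  have hzz : z = Real.exp (-v) * (Real.cos θ + Real.sin θ * Complex.I) := by
    rw [hz, Complex.exp_add, Complex.exp_mul_I]; push_cast; rfl
  have key : z / (1 - z)^2 =
    (((Real.cos θ * Real.cosh v - 1) / (2 * (Real.cos θ - Real.cosh v)^2) : ℝ) : ℂ) +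
    ((Real.sin θ * Real.sinh v / (2 * (Real.cos θ - Real.cosh v)^2) : ℝ) : ℂ) * Complex.I := by
    have hd : ((Real.cos θ : ℂ) - Real.cosh v) ≠ 0 := by exact_mod_cast hne2
    rw [Complex.ofReal_div, Complex.ofReal_div]
    simp only [Complex.ofReal_mul, Complex.ofReal_sub, Complex.ofReal_pow, Complex.ofReal_one, Complex.ofReal_ofNat]
    field_simp
    have hI := Complex.I_sq
    have hs : (Real.sin θ : ℂ)^2 + (Real.cos θ : ℂ)^2 = 1 := by
      exact_mod_cast Real.sin_sq_add_cos_sq θ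
    have hcv : (Real.cosh v : ℂ) = (Real.exp v + Real.exp (-v)) / 2 := by
      rw [Real.cosh_eq]; push_cast; rfl
    have hsv : (Real.sinh v : ℂ) = (Real.exp v - Real.exp (-v)) / 2 := by
      rw [Real.sinh_eq]; push_cast; rfl
    have her : (Real.exp v : ℂ) * Real.exp (-v) = 1 := by
      rw [← Complex.ofReal_mul, ← Real.exp_add]; simp
    rw [hcv, hsv, hzz]
    generalize (Real.exp v : ℂ) = p at *
    generalize (Real.exp (-v) : ℂ) = q at *
    generalize (Real.sin θ : ℂ) = s at *
    generalize (Real.cos θ : ℂ) = c at *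
    generalize Complex.I = i at *
    clear * - hI hs her
    grind
  convert h' using 1
  · ext n
    rw [hz, ← Complex.exp_nat_mul]
    have : (n:ℂ) * (-v + θ * Complex.I) = ((-n * v : ℝ):ℂ) + ((n * θ : ℝ):ℂ) * Complex.I := by
      push_cast; ring
    rw [this, Complex.exp_add, Complex.exp_mul_I, ← Complex.ofReal_exp, ← Complex.ofReal_cos, ← Complex.ofReal_sin, ← Complex.ofReal_natCast, Complex.re_ofReal_mul, Complex.re_ofReal_mul]
    simp only [Complex.add_re, Complex.ofReal_re, Complex.re_ofReal_mul, Complex.I_re, mul_zero, add_zero, mul_assoc]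
  · rw [key]
    simp only [Complex.add_re, Complex.ofReal_re, Complex.re_ofReal_mul, Complex.I_re, mul_zero, add_zero]
    field_simp
    ring

lemma kernel_sum (m : ℕ) (u : ℝ) (hu : u ≠ 0) :
    (∫ θ in (0:ℝ)..Real.pi, (1 - Real.cos θ * Real.cosh u) / (Real.cos θ - Real.cosh u) ^ 2 *
        (Real.sin θ) ^ (2 * m)) =
    - ∑ n ∈ Finset.Icc (-(2 * m : ℤ)) (2 * m), (|n| : ℝ) * sC m n * Real.exp (-|(n:ℝ)| * |u|) := by
  have hv : 0 < |u| := abs_pos.2 hu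
  rw [← Real.cosh_abs u]
  set v := |u| with hvdef
  have hr : ‖Real.exp (-v)‖ < 1 := by simp [hv]
  have hb := (hasSum_coe_mul_geometric_of_norm_lt_one hr).summable
  have hb' : Summable (fun n : ℕ => (n:ℝ) * Real.exp (-n * v)) := by
    refine hb.congr fun n => ?_
    rw [← Real.exp_nat_mul]; ring_nf
  have h1 := intervalIntegral.hasSum_integral_of_dominated_convergence (a := 0) (b := Real.pi)
    (μ := volume)
    (F := fun (n : ℕ) (θ : ℝ) => (n:ℝ) * Real.exp (-n * v) * Real.cos (n * θ) * Real.sin θ ^ (2 * m))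
    (f := fun θ => (- (1/2) * ((1 - Real.cos θ * Real.cosh v) / (Real.cos θ - Real.cosh v)^2)) *
      Real.sin θ ^ (2 * m))
    (fun n _ => (n:ℝ) * Real.exp (-n * v))
    (fun n => by apply Continuous.aestronglyMeasurable; fun_prop)
    (fun n => Filter.Eventually.of_forall fun t _ => by
      rw [norm_mul, norm_mul, Real.norm_of_nonneg (by positivity : 0 ≤ (n:ℝ) * Real.exp (-n * v)), norm_pow, mul_assoc]
      apply mul_le_of_le_one_right (by positivity)
      exact mul_le_one₀ (Real.abs_cos_le_one _) (by positivity) (pow_le_one₀ (norm_nonneg _) (Real.abs_sin_le_one _)))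
    (Filter.Eventually.of_forall fun t _ => hb')
    (by simp)
    (Filter.Eventually.of_forall fun t _ => (poisson v t hv).mul_right _)
  have e : ∀ n : ℕ, (∫ θ in (0:ℝ)..Real.pi, (n:ℝ) * Real.exp (-n * v) * Real.cos (n * θ) * Real.sin θ ^ (2 * m))
      = (n:ℝ) * sC m n * Real.exp (-n * v) := by
    intro n
    unfold sC
    rw [mul_right_comm, ← intervalIntegral.integral_const_mul]
    congr 1; ext θ; push_cast; ring
  simp only [e] at h1
  have h2 : HasSum (fun n : ℤ => (|n| : ℝ) * sC m n * Real.exp (-|(n:ℝ)| * v)) _ :=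
    HasSum.of_nat_of_neg (by simpa using h1) (by simpa [sC_neg] using h1)
  have h3 : HasSum (fun n : ℤ => (|n| : ℝ) * sC m n * Real.exp (-|(n:ℝ)| * v))
      (∑ n ∈ Finset.Icc (-(2 * m : ℤ)) (2 * m), (|n| : ℝ) * sC m n * Real.exp (-|(n:ℝ)| * v)) := by
    apply hasSum_sum_of_ne_finset_zero
    intro n hn
    rw [sC_supp m n hn]; ring
  rw [h3.unique h2]
  simp only [mul_assoc, intervalIntegral.integral_const_mul]
  simp
  ring

/-- Power spectrum of the covariance kernel of the derivative of the spherical average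
process of the `d`-dimensional whole-space log-correlated Gaussian field. -/
theorem spherical_power_spectrum
    (d : ℕ) (hd : 4 ≤ d) (hde : Even d)
    (c : ℝ)
    (hc : c = Real.Gamma ((d : ℝ) / 2) /
      (2 * Real.sqrt Real.pi * Real.Gamma (((d : ℝ) - 1) / 2)))
    (K : ℝ → ℝ)
    (hK : ∀ u : ℝ, K u = c * ∫ θ in (0:ℝ)..Real.pi,
      (1 - Real.cos θ * Real.cosh u) / (Real.cos θ - Real.cosh u) ^ 2 *
        (Real.sin θ) ^ (d - 2)) :
    Integrable K ∧
    ∀ ω : ℝ,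
      (∫ u : ℝ, (K u : ℂ) * Complex.exp (-Complex.I * (ω : ℂ) * (u : ℂ)))
        = ((2 ^ (d - 2) * Real.Gamma ((d : ℝ) / 2) ^ 2 /
            ∏ k ∈ Finset.Icc 1 ((d - 2) / 2), (ω ^ 2 + ((d : ℝ) - 2 * k) ^ 2) : ℝ) : ℂ) := by
  obtain ⟨m, rfl⟩ : ∃ m, d = 2 * (m + 2) := by
    obtain ⟨r, rfl⟩ := hde
    exact ⟨r - 2, by omega⟩
  have hd2 : 2 * (m + 2) - 2 = 2 * (m + 1) := by omega
  have hd3 : 2 * (m + 1) / 2 = m + 1 := by omega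
  simp only [hd2, hd3] at *
  set S := Finset.Icc (-(2 * (m + 1 : ℕ) : ℤ)) (2 * (m + 1 : ℕ)) with hS
  set a : ℤ → ℝ := fun n => -c * ((|n| : ℝ) * sC (m + 1) n) with ha
  have hKae : K =ᵐ[volume] fun u => ∑ n ∈ S, a n * Real.exp (-|(n:ℝ)| * |u|) := by
    have : ∀ᵐ u : ℝ, u ≠ 0 := by
      simp [ae_iff]
    filter_upwards [this] with u hu
    rw [hK, kernel_sum (m + 1) u hu, mul_neg, ← neg_mul, Finset.mul_sum]
    refine Finset.sum_congr rfl fun n _ => ?_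
    simp only [ha]; ring
  have hint : ∀ ω : ℝ, ∀ n ∈ S, Integrable (fun u : ℝ => (a n : ℂ) * ((Real.exp (-|(n:ℝ)| * |u|) : ℂ) * Complex.exp (-Complex.I * ω * u))) := by
    intro ω n _
    by_cases hn : n = 0
    · simp [ha, hn]
    · exact (ft_exp |(n:ℝ)| (by positivity) ω).1.const_mul _
  constructor
  · refine Integrable.congr ?_ hKae.symm
    refine integrable_finsetSum _ fun n hn => ?_
    have h := (hint 0 n hn).re
    refine h.congr (Filter.Eventually.of_forall fun u => ?_)
    simp only [Complex.ofReal_zero, mul_zero, zero_mul, Complex.exp_zero, mul_one]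
    rw [← Complex.ofReal_mul]
    exact Complex.ofReal_re _
  · intro ω
    have e1 : (∫ u : ℝ, (K u : ℂ) * Complex.exp (-Complex.I * (ω : ℂ) * (u : ℂ))) =
        ∫ u : ℝ, ∑ n ∈ S, (a n : ℂ) * ((Real.exp (-|(n:ℝ)| * |u|) : ℂ) * Complex.exp (-Complex.I * ω * u)) := by
      refine integral_congr_ae ?_
      filter_upwards [hKae] with u hu
      rw [hu, Complex.ofReal_sum, Finset.sum_mul]
      refine Finset.sum_congr rfl fun n _ => ?_
      rw [Complex.ofReal_mul, mul_assoc]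
    rw [e1, integral_finsetSum _ (hint ω)]
    have e2 : ∀ n ∈ S, (∫ u : ℝ, (a n : ℂ) * ((Real.exp (-|(n:ℝ)| * |u|) : ℂ) * Complex.exp (-Complex.I * ω * u))) =
        ((-2 * c * ((n:ℝ)^2 / (ω^2 + n^2) * sC (m+1) n) : ℝ) : ℂ) := by
      intro n _
      by_cases hn : n = 0
      · simp [ha, hn]
      · rw [integral_const_mul, (ft_exp |(n:ℝ)| (by positivity) ω).2, ← Complex.ofReal_mul]
        congr 1
        simp only [ha, sq_abs]
        rw [← sq_abs (n:ℝ)]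
        ring
    rw [Finset.sum_congr rfl e2, ← Complex.ofReal_sum, ← Finset.mul_sum]
    congr 1
    have e3 : ∑ n ∈ S, (n:ℝ)^2 / (ω^2 + n^2) * sC (m+1) n = GG (m+1) ω := by
      unfold GG
      rw [tsum_eq_sum]
      intro n hn; rw [sC_supp _ n hn, mul_zero]
    have e4 : ∏ k ∈ Finset.Icc 1 (m + 1), (ω ^ 2 + (((2 * (m + 2) : ℕ) : ℝ) - 2 * k) ^ 2) =
        ∏ j ∈ Finset.range (m+1), (ω^2 + 4 * ((j:ℝ)+1)^2) := by
      refine Finset.prod_nbij' (fun k => m + 1 - k) (fun j => m + 1 - j) ?_ ?_ ?_ ?_ ?_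
      · intro k hk; simp at hk ⊢; omega
      · intro k hk; simp at hk ⊢; omega
      · intro k hk; simp at hk ⊢; omega
      · intro k hk; simp at hk ⊢; omega
      · intro k hk
        have hk' : k ≤ m + 1 := (Finset.mem_Icc.1 hk).2
        rw [Nat.cast_sub hk']; push_cast; ring
    have hP : ∏ j ∈ Finset.range (m+1), (ω^2 + 4 * ((j:ℝ)+1)^2) ≠ 0 :=
      Finset.prod_ne_zero_iff.2 fun j _ => by positivity
    rw [e3, e4, eq_div_iff hP, mul_assoc, GG_eq, hc]
    have g1 : Real.Gamma (((2 * (m + 2) : ℕ) : ℝ) / 2) = (m + 1).factorial := by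
      rw [← Real.Gamma_nat_eq_factorial]; congr 1; push_cast; ring
    have g2 : ((((2 * (m + 2) : ℕ) : ℝ)) - 1) / 2 = ((m + 1 : ℕ) : ℝ) + 1 / 2 := by
      push_cast; ring
    rw [g1, g2]
    have g3 := Gamma_half (m + 1)
    have g4 : Real.Gamma (((m + 1 : ℕ) : ℝ) + 1 / 2) ≠ 0 := (Real.Gamma_pos_of_pos (by positivity)).ne'
    have g5 : Real.sqrt Real.pi ≠ 0 := by positivity
    have g6 : Real.sqrt Real.pi ^ 2 = Real.pi := Real.sq_sqrt Real.pi_pos.le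
    rw [pow_mul, show (2:ℝ)^2 = 4 by norm_num]
    generalize Real.Gamma (((m + 1 : ℕ) : ℝ) + 1 / 2) = G at *
    generalize Real.sqrt Real.pi = q at *
    rw [← g6]
    generalize (((m + 1).factorial : ℕ) : ℝ) = F at *
    generalize (((2 * (m + 1)).factorial : ℕ) : ℝ) = F2 at *
    field_simp
    linear_combination -F * g3
end

section
/- For every θ ∈ (0, π] and every ω ∈ ℝ with ω ≠ 0, the function u ↦ (1 − cos θ · cosh u)/(cos θ − cosh u)² is integrable on ℝ and ∫_ℝ (1 − cos θ · cosh u)/(cos θ − cosh u)² · e^{−iωu} du = (2πω/(e^{πω} − e^{−πω})) · (e^{(θ−π)ω} + e^{−(θ−π)ω}). -/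
open MeasureTheory

namespace CoshKernel

open Complex Filter Topology

lemma cosh_lower (x : ℝ) : 1 + x ^ 2 / 4 ≤ Real.cosh x := by
  have h1 := Real.quadratic_le_exp_of_nonneg (abs_nonneg x)
  have h2 := Real.add_one_le_exp (-|x|)
  rw [← Real.cosh_abs, Real.cosh_eq]
  rw [sq_abs] at h1
  linarith

lemma integrable_inv (d : ℝ) (hd : -1 < d) (hd1 : d ≤ 1) :
    Integrable (fun x : ℝ => (Real.cosh x + d)⁻¹) := by
  have h := (integrable_inv_one_add_sq).const_mul (8 / (1 + d))
  have hpos : ∀ x : ℝ, 0 < Real.cosh x + d := fun x => by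
    have := Real.one_le_cosh x; linarith
  refine h.mono' ?_ ?_
  · apply Continuous.aestronglyMeasurable
    exact (Real.continuous_cosh.add continuous_const).inv₀ (fun x => (hpos x).ne')
  · refine Eventually.of_forall fun x => ?_
    rw [Real.norm_of_nonneg (inv_nonneg.2 (hpos x).le)]
    have hx := cosh_lower x
    have h1 : 0 < 1 + d := by linarith
    rw [← one_div, div_mul_eq_mul_div, div_le_div_iff₀ (hpos x) h1]
    rw [← div_eq_mul_inv, div_mul_eq_mul_div, le_div_iff₀ (by positivity)]
    nlinarith [sq_nonneg x, mul_nonneg (sq_nonneg x) (sub_nonneg.2 hd1)]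

lemma norm_den (x y : ℝ) : ‖(1 : ℂ) + cosh (x + y * I)‖ = Real.cosh x + Real.cos y := by
  have hre : (1 : ℂ) + cosh (x + y * I) =
      ((1 + Real.cosh x * Real.cos y : ℝ) : ℂ) + ((Real.sinh x * Real.sin y : ℝ) : ℂ) * I := by
    rw [Complex.cosh_add, Complex.cosh_mul_I, Complex.sinh_mul_I]
    push_cast
    ring
  have hn : 0 ≤ Real.cosh x + Real.cos y := by
    linarith [Real.one_le_cosh x, Real.neg_one_le_cos y]
  rw [hre, Complex.norm_add_mul_I, Real.sqrt_eq_iff_eq_sq (by positivity) hn]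
  have h1 := Real.cosh_sq x
  have h2 := Real.sin_sq_add_cos_sq y
  have h3 : Real.sin y ^ 2 = 1 - Real.cos y ^ 2 := by linarith
  rw [mul_pow, h3]
  have h4 : Real.sinh x ^ 2 = Real.cosh x ^ 2 - 1 := by linarith
  rw [h4]; ring

lemma cos_gt {y : ℝ} (hy : |y| < Real.pi) : -1 < Real.cos y := by
  rw [← Real.cos_abs, ← Real.cos_pi]
  exact Real.cos_lt_cos_of_nonneg_of_le_pi (abs_nonneg y) le_rfl hy

lemma den_ne (x : ℝ) {y : ℝ} (hy : |y| < Real.pi) : (1 : ℂ) + cosh (x + y * I) ≠ 0 := by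
  rw [← norm_pos_iff, norm_den]
  linarith [Real.one_le_cosh x, cos_gt hy]

/-- The shifted kernel. -/
noncomputable def g (ω : ℝ) (z : ℂ) : ℂ := cexp (-I * ω * z) / (1 + cosh z)

lemma norm_g (ω x y : ℝ) :
    ‖g ω (x + y * I)‖ = Real.exp (ω * y) * (Real.cosh x + Real.cos y)⁻¹ := by
  rw [g, norm_div, norm_den, Complex.norm_exp, div_eq_mul_inv]
  congr 2
  simp

lemma g_diff (ω : ℝ) {z : ℂ} (hz : |z.im| < Real.pi) : DifferentiableAt ℂ (g ω) z := by
  have h := den_ne z.re hz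
  rw [Complex.re_add_im] at h
  unfold g
  refine DifferentiableAt.div (by fun_prop) ?_ h
  exact (Complex.differentiable_cosh z).const_add 1

lemma g_line_integrable (ω : ℝ) {b : ℝ} (hb : |b| < Real.pi) :
    Integrable (fun x : ℝ => g ω (x + b * I)) := by
  refine ((integrable_inv (Real.cos b) (cos_gt hb) (Real.cos_le_one b)).const_mul
    (Real.exp (ω * b))).mono' ?_ ?_
  · apply Continuous.aestronglyMeasurable
    rw [continuous_iff_continuousAt]
    intro x
    have : ContinuousAt (g ω) ((fun x : ℝ => (x + b * I : ℂ)) x) :=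
      (g_diff ω (by simpa using hb)).continuousAt
    exact ContinuousAt.comp (f := fun x : ℝ => (x + b * I : ℂ)) this (by fun_prop)
  · exact Eventually.of_forall fun x => (norm_g ω x b).le

lemma vert_bound (ω : ℝ) {b : ℝ} (T : ℝ) (hT : T ≠ 0) :
    ‖∫ y : ℝ in (0 : ℝ)..b, g ω (T + y * I)‖ ≤
      Real.exp (|ω| * |b|) * (T ^ 2 / 4)⁻¹ * |b| := by
  have := intervalIntegral.norm_integral_le_of_norm_le_const (a := (0 : ℝ)) (b := b)
    (C := Real.exp (|ω| * |b|) * (T ^ 2 / 4)⁻¹) (f := fun y : ℝ => g ω (T + y * I)) ?_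
  · simpa using this
  · intro y hy
    have absy : |y| ≤ |b| := by
      simpa using Set.abs_sub_left_of_mem_uIcc (Set.uIoc_subset_uIcc hy)
    rw [norm_g]
    have hT2 : 0 < T ^ 2 := by positivity
    have k1 : ω * y ≤ |ω| * |b| := by
      calc ω * y ≤ |ω * y| := le_abs_self _
        _ = |ω| * |y| := abs_mul _ _
        _ ≤ _ := by gcongr
    have k2 : T ^ 2 / 4 ≤ Real.cosh T + Real.cos y := by
      linarith [cosh_lower T, Real.neg_one_le_cos y]
    exact mul_le_mul (Real.exp_le_exp.2 k1) (inv_anti₀ (by positivity) k2)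
      (inv_nonneg.2 (le_trans (by positivity) k2)) (Real.exp_pos _).le

lemma shift (ω : ℝ) {b : ℝ} (hb : |b| < Real.pi) :
    ∫ x : ℝ, g ω (x + b * I) = ∫ x : ℝ, g ω x := by
  have h0 : Integrable (fun x : ℝ => g ω x) := by
    have := g_line_integrable ω (b := 0) (by simpa using Real.pi_pos)
    simpa using this
  have t1 := intervalIntegral_tendsto_integral (g_line_integrable ω hb)
        tendsto_neg_atTop_atBot tendsto_id
  have t0 := intervalIntegral_tendsto_integral h0
        tendsto_neg_atTop_atBot tendsto_id
  have C : ∀ T : ℝ, (∫ x : ℝ in -T..T, g ω x) - (∫ x : ℝ in -T..T, g ω (x + b * I))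
      + I * (∫ y : ℝ in (0 : ℝ)..b, g ω (T + y * I))
      - I * (∫ y : ℝ in (0 : ℝ)..b, g ω ((-T : ℝ) + y * I)) = 0 := by
    intro T
    have :=
      integral_boundary_rect_eq_zero_of_differentiableOn (g ω) (-T)
        (T + b * I)
        (by
          intro z hz
          refine (g_diff ω ?_).differentiableWithinAt
          have h2 := hz.2
          simp only [Set.mem_preimage] at h2
          have : |z.im| ≤ |b| := by
            simpa using Set.abs_sub_left_of_mem_uIcc h2
          exact this.trans_lt hb)
    simpa only [neg_im, ofReal_im, neg_zero, ofReal_zero, zero_mul, add_zero, neg_re,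
      ofReal_re, add_re, mul_re, I_re, mul_zero, I_im, tsub_zero, add_im, mul_im,
      mul_one, zero_add, smul_eq_mul, ofReal_neg] using this
  have B : Tendsto (fun T : ℝ => Real.exp (|ω| * |b|) * (T ^ 2 / 4)⁻¹ * |b|) atTop (𝓝 0) := by
    have : Tendsto (fun T : ℝ => (T ^ 2 / 4)⁻¹) atTop (𝓝 0) :=
      ((tendsto_pow_atTop two_ne_zero).atTop_div_const (by norm_num)).inv_tendsto_atTop
    simpa using (this.const_mul (Real.exp (|ω| * |b|))).mul_const |b|
  have v1 : Tendsto (fun T : ℝ => ∫ y : ℝ in (0 : ℝ)..b, g ω (T + y * I)) atTop (𝓝 0) := by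
    refine squeeze_zero_norm' ?_ B
    filter_upwards [eventually_ne_atTop 0] with T hT using vert_bound ω T hT
  have v2 : Tendsto (fun T : ℝ => ∫ y : ℝ in (0 : ℝ)..b, g ω ((-T : ℝ) + y * I)) atTop
      (𝓝 0) := by
    refine squeeze_zero_norm' ?_ B
    filter_upwards [eventually_ne_atTop 0] with T hT
    simpa using vert_bound ω (b := b) (-T) (neg_ne_zero.2 hT)
  have t2 := ((t0.sub t1).add (v1.const_mul I)).sub (v2.const_mul I)
  have t3 := t2.congr (f₂ := fun _ => (0 : ℂ)) (fun T => by simpa using C T)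
  have := tendsto_nhds_unique t3 tendsto_const_nhds
  simp only [mul_zero, add_zero, sub_zero] at this
  exact (sub_eq_zero.1 this).symm

lemma base (ω : ℝ) (hω : ω ≠ 0) :
    ∫ x : ℝ, g ω x = 4 * Real.pi * ω / (cexp (Real.pi * ω) - cexp (-(Real.pi * ω))) := by
  have hG := Complex.Gamma_mul_Gamma_eq_betaIntegral (s := 1 - I * ω) (t := 1 + I * ω)
    (by simp) (by simp)
  have h2 : Complex.Gamma (1 - I * ω + (1 + I * ω)) = 1 := by
    rw [show (1 - I * ω + (1 + I * ω) : ℂ) = 1 + 1 by ring,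
      Complex.Gamma_add_one _ one_ne_zero, Complex.Gamma_one, one_mul]
  have hne : I * (ω : ℂ) ≠ 0 := mul_ne_zero I_ne_zero (by exact_mod_cast hω)
  have hrefl := Complex.Gamma_mul_Gamma_one_sub (I * ω)
  rw [h2, one_mul, add_comm 1 (I * (ω : ℂ)), Complex.Gamma_add_one _ hne] at hG
  have hbeta : betaIntegral (1 - I * ω) (1 + I * ω) = ∫ x : ℝ, g ω x / 2 := by
    rw [betaIntegral, intervalIntegral.integral_of_le zero_le_one, integral_Ioc_eq_integral_Ioo,
      ← Real.range_sigmoid, ← Set.image_univ,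
      integral_image_eq_integral_abs_deriv_smul MeasurableSet.univ
        (fun x _ => (Real.hasDerivAt_sigmoid x).hasDerivWithinAt)
        Real.sigmoid_injective.injOn, setIntegral_univ]
    congr 1
    ext x
    have p0 := Real.sigmoid_pos x
    have p1 : 0 < 1 - Real.sigmoid x := by linarith [Real.sigmoid_lt_one x]
    have hlog : Real.log (1 - Real.sigmoid x) = Real.log (Real.sigmoid x) - x := by
      rw [← Real.sigmoid_neg, ← Real.sigmoid_mul_rexp_neg, Real.log_mul p0.ne'
        (Real.exp_pos _).ne', Real.log_exp]
      ring
    have hprod : Real.sigmoid x * (1 - Real.sigmoid x) = (1 + Real.cosh x)⁻¹ / 2 := by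
      rw [Real.sigmoid_def, Real.cosh_eq]
      have e1 := Real.exp_pos x
      rw [Real.exp_neg]
      field_simp
      ring
    rw [abs_of_pos (mul_pos p0 p1), hprod]
    have c1 : (1 - (Real.sigmoid x : ℂ)) = ((1 - Real.sigmoid x : ℝ) : ℂ) := by push_cast; rfl
    rw [c1, Complex.cpow_def_of_ne_zero (by exact_mod_cast p0.ne'),
      Complex.cpow_def_of_ne_zero (by exact_mod_cast p1.ne'), ← Complex.exp_add,
      ← Complex.ofReal_log p0.le, ← Complex.ofReal_log p1.le, hlog, g, Complex.real_smul]
    have : ((Real.log (Real.sigmoid x) : ℝ) : ℂ) * (1 - I * ω - 1) +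
        ((Real.log (Real.sigmoid x) - x : ℝ) : ℂ) * (1 + I * ω - 1) = -I * ω * x := by
      push_cast; ring
    rw [this]
    push_cast
    ring
  rw [add_comm (I * (ω : ℂ)) 1, hbeta, integral_div] at hG
  have hsin : Complex.sin (Real.pi * (I * ω)) =
      (cexp (Real.pi * ω) - cexp (-(Real.pi * ω))) / 2 * I := by
    rw [show (Real.pi * (I * ω) : ℂ) = (Real.pi * ω) * I by ring, Complex.sin_mul_I, Complex.sinh]
  have : ∫ x : ℝ, g ω x = 2 * (I * ω) * (Complex.Gamma (I * ω) * Complex.Gamma (1 - I * ω)) := by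
    linear_combination (-2) * hG
  rw [this, hrefl, hsin]
  have hd : cexp (Real.pi * ω) - cexp (-(Real.pi * ω)) ≠ 0 := by
    have : Real.exp (Real.pi * ω) - Real.exp (-(Real.pi * ω)) ≠ 0 := by
      rw [sub_ne_zero, Ne, Real.exp_eq_exp]
      intro h
      have : Real.pi * ω = 0 := by linarith
      exact (mul_ne_zero Real.pi_ne_zero hω) this
    exact_mod_cast this
  have := I_ne_zero
  field_simp
  ring

end CoshKernel

open CoshKernel in
/-- Fourier transform of `u ↦ (1 - cos θ · cosh u)/(cos θ - cosh u)²`. -/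
theorem fourier_transform_cosh_kernel
    (θ ω : ℝ) (hθ : θ ∈ Set.Ioc (0 : ℝ) Real.pi) (hω : ω ≠ 0) :
    Integrable (fun u : ℝ =>
      (1 - Real.cos θ * Real.cosh u) / (Real.cos θ - Real.cosh u) ^ 2) ∧
    (∫ u : ℝ,
        ((1 - Real.cos θ * Real.cosh u) / (Real.cos θ - Real.cosh u) ^ 2 : ℝ) *
          Complex.exp (-Complex.I * (ω : ℂ) * (u : ℂ)))
      = ((2 * Real.pi * ω / (Real.exp (Real.pi * ω) - Real.exp (-(Real.pi * ω))) *
          (Real.exp ((θ - Real.pi) * ω) + Real.exp (-((θ - Real.pi) * ω))) : ℝ) : ℂ) := by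
  obtain ⟨h0, hpi⟩ := hθ
  have ha : |Real.pi - θ| < Real.pi := by rw [abs_lt]; constructor <;> linarith
  have ha' : |-(Real.pi - θ)| < Real.pi := by rwa [abs_neg]
  have hcos : Real.cos (Real.pi - θ) = -Real.cos θ := Real.cos_pi_sub θ
  have hc1 : -1 < -Real.cos θ := hcos ▸ cos_gt ha
  have hc2 : -Real.cos θ ≤ 1 := by linarith [Real.neg_one_le_cos θ]
  have hpos : ∀ u : ℝ, 0 < Real.cosh u + -Real.cos θ := fun u => by
    linarith [Real.one_le_cosh u]
  have hne : ∀ u : ℝ, (Real.cos θ - Real.cosh u) ≠ 0 := fun u => by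
    have := hpos u
    intro h; linarith
  constructor
  · refine (integrable_inv _ hc1 hc2).mono' ?_ ?_
    · apply Continuous.aestronglyMeasurable
      have := Real.continuous_cosh
      exact Continuous.div (by fun_prop) (by fun_prop) (fun u => pow_ne_zero 2 (hne u))
    · refine Filter.Eventually.of_forall fun u => ?_
      have hu := hpos u
      have h1 := Real.one_le_cosh u
      rw [norm_div, norm_pow, Real.norm_eq_abs, Real.norm_eq_abs, sq_abs,
        div_le_iff₀ (by have := hne u; positivity)]
      rw [show (Real.cosh u + -Real.cos θ)⁻¹ * (Real.cos θ - Real.cosh u) ^ 2 =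
        Real.cosh u + -Real.cos θ by field_simp; ring]
      rw [abs_le]
      constructor <;> nlinarith
  · have key : ∀ u : ℝ,
        (((1 - Real.cos θ * Real.cosh u) / (Real.cos θ - Real.cosh u) ^ 2 : ℝ) : ℂ) *
          Complex.exp (-Complex.I * (ω : ℂ) * (u : ℂ)) =
        (Complex.exp ((θ - Real.pi) * ω) / 2) * g ω (u + (Real.pi - θ : ℝ) * Complex.I) +
        (Complex.exp (-((θ - Real.pi) * ω)) / 2) *
          g ω (u + (-(Real.pi - θ) : ℝ) * Complex.I) := by
      intro u
      have d1 := den_ne u ha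
      have d2 := den_ne u ha'
      have e1 : Complex.exp ((θ - Real.pi) * ω) *
          Complex.exp (-Complex.I * ω * (u + (Real.pi - θ : ℝ) * Complex.I)) =
          Complex.exp (-Complex.I * ω * u) := by
        rw [← Complex.exp_add]
        congr 1
        push_cast
        linear_combination (-(Real.pi - θ) * ω : ℂ) * Complex.I_sq
      have e2 : Complex.exp (-((θ - Real.pi) * ω)) *
          Complex.exp (-Complex.I * ω * (u + (-(Real.pi - θ) : ℝ) * Complex.I)) =
          Complex.exp (-Complex.I * ω * u) := by
        rw [← Complex.exp_add]
        congr 1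
        push_cast
        linear_combination ((Real.pi - θ) * ω : ℂ) * Complex.I_sq
      have hk : (((1 - Real.cos θ * Real.cosh u) / (Real.cos θ - Real.cosh u) ^ 2 : ℝ) : ℂ) =
          1 / 2 * (1 / (1 + Complex.cosh (u + (Real.pi - θ : ℝ) * Complex.I)) +
            1 / (1 + Complex.cosh (u + (-(Real.pi - θ) : ℝ) * Complex.I))) := by
        have x1 : Complex.cosh (u + (Real.pi - θ : ℝ) * Complex.I) =
            -(Real.cosh u * Real.cos θ : ℝ) + (Real.sinh u * Real.sin θ : ℝ) * Complex.I := by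
          rw [Complex.cosh_add, Complex.cosh_mul_I, Complex.sinh_mul_I, ← Complex.ofReal_cos,
            ← Complex.ofReal_sin, hcos, Real.sin_pi_sub]
          push_cast
          ring
        have x2 : Complex.cosh (u + (-(Real.pi - θ) : ℝ) * Complex.I) =
            -(Real.cosh u * Real.cos θ : ℝ) - (Real.sinh u * Real.sin θ : ℝ) * Complex.I := by
          rw [Complex.cosh_add, Complex.cosh_mul_I, Complex.sinh_mul_I, ← Complex.ofReal_cos,
            ← Complex.ofReal_sin, Real.cos_neg, Real.sin_neg, hcos, Real.sin_pi_sub]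
          push_cast
          ring
        rw [x1] at d1 ⊢
        rw [x2] at d2 ⊢
        have hn : ((Real.cos θ - Real.cosh u : ℝ) : ℂ) ≠ 0 := by exact_mod_cast hne u
        have hp : (1 + (-((Real.cosh u * Real.cos θ : ℝ) : ℂ) +
            (Real.sinh u * Real.sin θ : ℝ) * Complex.I)) *
            (1 + (-((Real.cosh u * Real.cos θ : ℝ) : ℂ) -
            (Real.sinh u * Real.sin θ : ℝ) * Complex.I)) =
            ((Real.cos θ - Real.cosh u : ℝ) : ℂ) ^ 2 := by
          have q : (1 - Real.cosh u * Real.cos θ) ^ 2 + (Real.sinh u * Real.sin θ) ^ 2 =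
              (Real.cos θ - Real.cosh u) ^ 2 := by
            have h4 : Real.sinh u ^ 2 = Real.cosh u ^ 2 - 1 := by
              linarith [Real.cosh_sq u]
            rw [mul_pow, Real.sin_sq, h4]; ring
          rw [← Complex.ofReal_pow, ← q]
          push_cast
          linear_combination (-(Complex.sinh u * Complex.sin θ) ^ 2 : ℂ) * Complex.I_sq
        rw [div_add_div _ _ d1 d2, hp]
        push_cast
        ring
      rw [hk, g, g]
      linear_combination
        (-(1 / 2) / (1 + Complex.cosh (u + (Real.pi - θ : ℝ) * Complex.I))) * e1 -
        ((1 / 2) / (1 + Complex.cosh (u + (-(Real.pi - θ) : ℝ) * Complex.I))) * e2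
    simp_rw [key]
    rw [integral_add ((g_line_integrable ω ha).const_mul _)
      ((g_line_integrable ω ha').const_mul _), integral_const_mul, integral_const_mul,
      shift ω ha, shift ω ha', base ω hω]
    push_cast
    ring
end
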